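/- arXiv:1310.0960 — 2 statements merged into one kernel-verified Lean document; each statement's English description precedes it below -/
import Mathlib

section
/- Fix an integer k ≥ 2, a real constant C ≥ 1, reals g > 0, p > 1, 0 < δ ≤ 1 with p·δ^{k−1} ≤ 1, and a real ε' ≥ 0. Let γ t := g·p^{t+1}·k^t, γ' t := g·k^t and ε := δ·ε'. Define K and S as follows. For natural numbers M, m define K(M, m) := (k·M)! · binom(k·M − 1, m − 1) / m! (as a real number). For a positive function γ on ℕ and a natural number t_m define S_γ(t_m, ε, ε₀) as the finite sum, over all pairs of sequences n, e : {0,…,t_m} → ℕ satisfying n 0 = 1, e t ≤ n t for all t ≤ t_m, 1 ≤ n (t+1) ≤ k·(n t − e t) for all t < t_m, and e t_m = n t_m, of the term [∏_{t=0}^{t_m−1} binom(n t, e t) · K(n t − e t, n (t+1)) · ε^{e t} · C^{k·(n t − e t)} · (γ t)^{−(k·(n t − e t) − n (t+1))}] · ε₀^{n t_m}. Then for every natural number t_m: S_γ(t_m, ε, ε) ≤ δ·p^{−t_m} · S_{γ'}(t_m, ε', ε'). -/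
/-- `K(M, m) = (k·M)! · binom(k·M − 1, m − 1) / m!`, the bound on the number of ways to
arrange the `k·M` lines leaving `M` sites so that they enter exactly `m` sites. -/
noncomputable def K (k M m : ℕ) : ℝ :=
  (Nat.factorial (k * M) : ℝ) * ((k * M - 1).choose (m - 1) : ℝ) / (Nat.factorial m : ℝ)

/-- `S γ (t_m, ε, ε₀)`: the weighted sum over graphs of height `t_m`, indexed by pairs of
sequences `n, e : {0,…,t_m} → ℕ` with `n 0 = 1`, `e t ≤ n t`, `1 ≤ n (t+1) ≤ k·(n t − e t)`
for `t < t_m`, and `e t_m = n t_m`.  (Since these constraints force `n t ≤ k^t ≤ k^{t_m}`,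
taking values in `Fin (k^{t_m} + 1)` captures every admissible pair of sequences.) -/
noncomputable def S (k : ℕ) (C : ℝ) (γ : ℕ → ℝ) (tm : ℕ) (ε ε₀ : ℝ) : ℝ :=
  ∑ ne ∈ Finset.univ.filter
      (fun ne : (Fin (tm + 1) → Fin (k ^ tm + 1)) × (Fin (tm + 1) → Fin (k ^ tm + 1)) =>
        (ne.1 0 : ℕ) = 1 ∧
        (∀ t : Fin (tm + 1), (ne.2 t : ℕ) ≤ (ne.1 t : ℕ)) ∧
        (∀ t : Fin tm, 1 ≤ (ne.1 t.succ : ℕ) ∧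
          (ne.1 t.succ : ℕ) ≤ k * ((ne.1 t.castSucc : ℕ) - (ne.2 t.castSucc : ℕ))) ∧
        (ne.2 (Fin.last tm) : ℕ) = (ne.1 (Fin.last tm) : ℕ)),
    (∏ t : Fin tm,
        ((ne.1 t.castSucc : ℕ).choose (ne.2 t.castSucc : ℕ) : ℝ) *
          K k ((ne.1 t.castSucc : ℕ) - (ne.2 t.castSucc : ℕ)) (ne.1 t.succ : ℕ) *
          ε ^ (ne.2 t.castSucc : ℕ) *
          C ^ (k * ((ne.1 t.castSucc : ℕ) - (ne.2 t.castSucc : ℕ))) *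
          (γ (t : ℕ) ^ (k * ((ne.1 t.castSucc : ℕ) - (ne.2 t.castSucc : ℕ)) -
              (ne.1 t.succ : ℕ)))⁻¹) *
      ε₀ ^ (ne.1 (Fin.last tm) : ℕ)

theorem K_nonneg (k M m : ℕ) : 0 ≤ K k M m := by
  unfold K
  positivity

/-- In a graph of height `m`, some `h` satisfies: the graph carries at least `h * (k - 1) + 1`
error sites, while the repeated choices contribute at least `m - h` to the exponent of `p`. -/
theorem exists_tree_height (k : ℕ) (hk : 1 ≤ k) (m : ℕ) (n e : Fin (m + 1) → ℕ) (h0 : n 0 = 1)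
    (he : ∀ t, e t ≤ n t)
    (hn : ∀ t : Fin m, 1 ≤ n t.succ ∧ n t.succ ≤ k * (n t.castSucc - e t.castSucc)) :
    ∃ h : ℕ, m ≤ h + ∑ t : Fin m,
        ((t : ℕ) + 1) * (k * (n t.castSucc - e t.castSucc) - n t.succ) ∧
      h * (k - 1) + 1 ≤ ∑ t : Fin m, e t.castSucc + n (Fin.last m) := by
  induction m with
  | zero =>
    refine ⟨0, by simp, ?_⟩
    simp [h0]
  | succ m ih =>
    obtain ⟨h, h1, h2⟩ := ih (fun t => n t.castSucc) (fun t => e t.castSucc) h0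
      (fun t => he _) (fun t => hn t.castSucc)
    have hl := hn (Fin.last m)
    have hel := he (Fin.last m).castSucc
    simp only [Fin.sum_univ_castSucc (n := m), Fin.val_castSucc, Fin.val_last,
      Fin.succ_last, Fin.succ_castSucc, Nat.succ_eq_add_one] at h1 h2 hl ⊢
    obtain ⟨d, hd⟩ := Nat.exists_eq_add_of_le hel
    obtain ⟨j, rfl⟩ := Nat.exists_eq_add_of_le' hk
    rw [hd] at h2
    rw [hd, Nat.add_sub_cancel_left] at hl ⊢
    rcases Nat.eq_zero_or_pos ((j + 1) * d - n (Fin.last (m + 1))) with hr | hr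
    · refine ⟨h + 1, by omega, ?_⟩
      have heq : n (Fin.last (m + 1)) = (j + 1) * d := by omega
      have hd1 : 1 ≤ d := by
        rcases Nat.eq_zero_or_pos d with rfl | hd0
        · simp at hl
          omega
        · exact hd0
      rw [heq]
      simp only [Nat.add_sub_cancel] at h2 ⊢
      nlinarith [Nat.mul_le_mul_left j hd1]
    · refine ⟨0, ?_, by omega⟩
      have := Nat.le_mul_of_pos_right (m + 1) hr
      omega

theorem pow_mul_inv_pow_le {k : ℕ} {p δ : ℝ} (hp : 1 < p) (hδ0 : 0 < δ) (hδ1 : δ ≤ 1)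
    (hpδ : p * δ ^ (k - 1) ≤ 1) {m h E R : ℕ} (hR : m ≤ h + R) (hE : h * (k - 1) + 1 ≤ E) :
    δ ^ E * (p ^ R)⁻¹ ≤ δ * (p ^ m)⁻¹ := by
  have hp0 : 0 < p := by linarith
  rw [← div_eq_mul_inv, ← div_eq_mul_inv, div_le_div_iff₀ (by positivity) (by positivity)]
  calc δ ^ E * p ^ m ≤ δ ^ (h * (k - 1) + 1) * p ^ (h + R) :=
        mul_le_mul (pow_le_pow_of_le_one hδ0.le hδ1 hE) (pow_le_pow_right₀ hp.le hR)
          (by positivity) (by positivity)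
    _ = (p * δ ^ (k - 1)) ^ h * (δ * p ^ R) := by
        rw [mul_pow, ← pow_mul, mul_comm (k - 1) h]
        ring
    _ ≤ 1 * (δ * p ^ R) := by
        gcongr
        exact pow_le_one₀ (by positivity) hpδ
    _ = δ * p ^ R := one_mul _

/-- Extracting the convergence factor: with `γ t = g·p^{t+1}·k^t`, `γ' t = g·k^t` and
`ε = δ·ε'`, one has `S_γ(t_m, ε, ε) ≤ δ·p^{−t_m}·S_{γ'}(t_m, ε', ε')`. -/
theorem S_decay_factor (k : ℕ) (hk : 2 ≤ k) (C : ℝ) (hC : 1 ≤ C)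
    (g p δ ε' : ℝ) (hg : 0 < g) (hp : 1 < p) (hδ0 : 0 < δ) (hδ1 : δ ≤ 1)
    (hpδ : p * δ ^ (k - 1) ≤ 1) (hε' : 0 ≤ ε') (tm : ℕ) :
    S k C (fun t => g * p ^ (t + 1) * (k : ℝ) ^ t) tm (δ * ε') (δ * ε') ≤
      δ * (p ^ tm)⁻¹ * S k C (fun t => g * (k : ℝ) ^ t) tm ε' ε' := by
  rw [S, S, Finset.mul_sum]
  refine Finset.sum_le_sum fun ne hne => ?_
  obtain ⟨h0, he, hn, -⟩ := (Finset.mem_filter.mp hne).2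
  obtain ⟨h, hR, hE⟩ := exists_tree_height k (by omega) tm (fun t => (ne.1 t : ℕ))
    (fun t => (ne.2 t : ℕ)) h0 he hn
  have hfac := pow_mul_inv_pow_le hp hδ0 hδ1 hpδ hR hE
  rw [pow_add, ← Finset.prod_pow_eq_pow_sum, ← Finset.prod_pow_eq_pow_sum,
    ← Finset.prod_inv_distrib, mul_right_comm, ← Finset.prod_mul_distrib] at hfac
  refine le_trans (le_of_eq ?_) (mul_le_mul_of_nonneg_right hfac ?_)
  · rw [mul_mul_mul_comm, ← Finset.prod_mul_distrib, mul_pow]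
    congr 1
    refine Finset.prod_congr rfl fun t _ => ?_
    simp only [mul_pow, mul_inv, pow_mul]
    ring
  · refine mul_nonneg (Finset.prod_nonneg fun t _ => ?_) (by positivity)
    have := K_nonneg k ((ne.1 t.castSucc : ℕ) - (ne.2 t.castSucc : ℕ)) (ne.1 t.succ : ℕ)
    positivity
end

section
/- Fix an integer k ≥ 2, a real constant C ≥ 1, reals g > 0, p > 1, 0 < δ ≤ 1 with p·δ^{k−1} ≤ 1, and a real ε' ≥ 0 such that k/g ≤ (1/C)·(1/(C·k))^{1/(k−1)} − (1/(C·k))^{k/(k−1)} and ε' ≤ (1/C)·(1/(C·k))^{1/(k−1)} − (1/(C·k))^{k/(k−1)} − k/g. Let γ t := g·p^{t+1}·k^t and ε := δ·ε'. Define K and S_γ as follows. For natural numbers M, m define K(M, m) := (k·M)! · binom(k·M − 1, m − 1) / m! (as a real number). For a natural number t_m define S_γ(t_m, ε, ε₀) as the finite sum, over all pairs of sequences n, e : {0,…,t_m} → ℕ satisfying n 0 = 1, e t ≤ n t for all t ≤ t_m, 1 ≤ n (t+1) ≤ k·(n t − e t) for all t < t_m, and e t_m = n t_m, of the term [∏_{t=0}^{t_m−1}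 binom(n t, e t) · K(n t − e t, n (t+1)) · ε^{e t} · C^{k·(n t − e t)} · (γ t)^{−(k·(n t − e t) − n (t+1))}] · ε₀^{n t_m}. Then for every natural number T: ∑_{t_m=0}^{T} S_γ(t_m, ε, ε) ≤ δ·(p/(p−1))·x̃, where x̃ := (1/C)·(1/(C·k))^{1/(k−1)} − k/g. -/
/-- If `φ` is superharmonic for the nonnegative transition weights `w`, then the weighted sum over
paths of length `h` ending with `φ` is at most the initial weight of `φ`. -/
theorem sum_path_le {α : Type*} [Fintype α] (w : α → α → ℝ) (φ : α → ℝ)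
    (hsuper : ∀ s, ∑ s', w s s' * φ s' ≤ φ s) (hw : ∀ s s', 0 ≤ w s s') (h : ℕ) :
    ∀ ι : α → ℝ, (∀ s, 0 ≤ ι s) →
      ∑ u : Fin (h + 1) → α,
        ι (u 0) * (∏ t : Fin h, w (u t.castSucc) (u t.succ)) * φ (u (Fin.last h)) ≤
      ∑ s, ι s * φ s := by
  induction h with
  | zero =>
    intro ι _
    refine le_of_eq ?_
    refine Fintype.sum_equiv (Equiv.funUnique (Fin 1) α) _ _ fun u => ?_
    simp
  | succ h ih =>
    intro ι hι
    calc _ = ∑ v : Fin (h + 1) → α, (∑ s, ι s * w s (v 0)) *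
            (∏ t : Fin h, w (v t.castSucc) (v t.succ)) * φ (v (Fin.last h)) := by
          rw [← (Fin.consEquiv fun _ : Fin (h + 2) => α).sum_comp, Fintype.sum_prod_type_right]
          refine Finset.sum_congr rfl fun v _ => ?_
          simp only [Finset.sum_mul]
          refine Finset.sum_congr rfl fun s _ => ?_
          rw [Fin.prod_univ_succ]
          simp [Fin.consEquiv, ← Fin.succ_last, mul_assoc]
      _ ≤ ∑ s', (∑ s, ι s * w s s') * φ s' :=
          ih (fun s' => ∑ s, ι s * w s s') fun s' =>
            Finset.sum_nonneg fun s _ => mul_nonneg (hι s) (hw s s')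
      _ = ∑ s, ι s * ∑ s', w s s' * φ s' := by
          simp only [Finset.sum_mul, Finset.mul_sum]
          rw [Finset.sum_comm]
          simp only [mul_assoc]
      _ ≤ _ := Finset.sum_le_sum fun s _ => mul_le_mul_of_nonneg_left (hsuper s) (hι s)

/-- A partial binomial sum with nonnegative terms is at most the full power. -/
theorem sum_choose_fin_le {x y : ℝ} (hx : 0 ≤ x) (hy : 0 ≤ y) (B N : ℕ) :
    ∑ m : Fin (B + 1), (N.choose m : ℝ) * x ^ (m : ℕ) * y ^ (N - m) ≤ (x + y) ^ N := by
  rw [Fin.sum_univ_eq_sum_range (fun m => (N.choose m : ℝ) * x ^ m * y ^ (N - m)), add_pow]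
  have hle : ∑ m ∈ Finset.range (B + 1), (N.choose m : ℝ) * x ^ m * y ^ (N - m) ≤
      ∑ m ∈ Finset.range (max (B + 1) (N + 1)), (N.choose m : ℝ) * x ^ m * y ^ (N - m) :=
    Finset.sum_le_sum_of_subset_of_nonneg (Finset.range_mono (le_max_left _ _)) fun _ _ _ => by positivity
  refine hle.trans (le_of_eq ?_)
  rw [← Finset.sum_subset (s₁ := Finset.range (N + 1))
    (Finset.range_mono (le_max_right _ _))]
  · exact Finset.sum_congr rfl fun m _ => by ring
  · intro m _ hm
    have hNm : N < m := by
      rw [Finset.mem_range] at hm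
      omega
    simp [Nat.choose_eq_zero_of_lt hNm]

/-- `K(M, m)` is at most `binom(kM, m)` times a power of any bound on `kM`. -/
theorem K_le {k M m L : ℕ} (hm : 1 ≤ m) (hmN : m ≤ k * M) (hL : k * M ≤ L) :
    K k M m ≤ ((k * M).choose m : ℝ) * (L : ℝ) ^ (k * M - m) := by
  unfold K
  generalize k * M = N at *
  have hfact : N.factorial ≤ m.factorial * L ^ (N - m) := by
    have h := Nat.factorial_mul_descFactorial (Nat.sub_le N m)
    rw [Nat.sub_sub_self hmN] at h
    rw [← h]
    exact Nat.mul_le_mul_left _ ((Nat.descFactorial_le_pow _ _).trans (Nat.pow_le_pow_left hL _))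
  have hchoose : (N - 1).choose (m - 1) ≤ N.choose m := by
    obtain ⟨m, rfl⟩ := Nat.exists_eq_add_of_le' hm
    obtain ⟨N, rfl⟩ := Nat.exists_eq_add_of_le' (hm.trans hmN)
    simp [Nat.choose_succ_succ]
  rw [div_le_iff₀ (by positivity)]
  have h : N.factorial * (N - 1).choose (m - 1) ≤ N.choose m * L ^ (N - m) * m.factorial :=
    (Nat.mul_le_mul hfact hchoose).trans (le_of_eq (by ring))
  exact_mod_cast h

/-- The weight of one layer, with the powers of `δ` and `p` split off. -/
theorem layer_le {k n e m t : ℕ} {C g p δ ε' : ℝ} (hk : 1 ≤ k) (hC : 0 ≤ C) (hg : 0 < g)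
    (hp : 1 ≤ p) (hδ : 0 ≤ δ) (hε' : 0 ≤ ε') (hn : n ≤ k ^ t) (hm : 1 ≤ m)
    (hmN : m ≤ k * (n - e)) :
    (n.choose e : ℝ) * K k (n - e) m * (δ * ε') ^ e * C ^ (k * (n - e)) *
        ((g * p ^ (t + 1) * (k : ℝ) ^ t) ^ (k * (n - e) - m))⁻¹ ≤
      (n.choose e : ℝ) * ε' ^ e * C ^ (k * (n - e)) *
          (((k * (n - e)).choose m : ℝ) * (k / g) ^ (k * (n - e) - m)) *
        (δ ^ e * (p ^ (k * (n - e) - m))⁻¹) := by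
  have hL : k * (n - e) ≤ k ^ (t + 1) := by
    rw [pow_succ']
    exact Nat.mul_le_mul_left _ ((Nat.sub_le _ _).trans hn)
  have hK := K_le hm hmN hL
  generalize k * (n - e) - m = D at *
  have hk0 : (0 : ℝ) < k := by exact_mod_cast hk
  have hp0 : 0 < p := by linarith
  have hpow : ((k ^ (t + 1) : ℕ) : ℝ) ^ D * ((g * p ^ (t + 1) * (k : ℝ) ^ t) ^ D)⁻¹ ≤
      (k / g) ^ D * (p ^ D)⁻¹ := by
    rw [← inv_pow, ← inv_pow, ← mul_pow, ← mul_pow]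
    refine pow_le_pow_left₀ (by positivity) ?_ D
    have heq : ((k ^ (t + 1) : ℕ) : ℝ) * (g * p ^ (t + 1) * (k : ℝ) ^ t)⁻¹ =
        k / g * (p ^ (t + 1))⁻¹ := by
      push_cast
      field_simp
      ring
    rw [heq]
    gcongr
    exact le_self_pow₀ hp (by omega)
  calc _ = ((n.choose e : ℝ) * (δ * ε') ^ e * C ^ (k * (n - e))) *
        (K k (n - e) m * ((g * p ^ (t + 1) * (k : ℝ) ^ t) ^ D)⁻¹) := by ring
    _ ≤ ((n.choose e : ℝ) * (δ * ε') ^ e * C ^ (k * (n - e))) *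
        ((((k * (n - e)).choose m : ℝ) * ((k ^ (t + 1) : ℕ) : ℝ) ^ D) *
          ((g * p ^ (t + 1) * (k : ℝ) ^ t) ^ D)⁻¹) := by gcongr
    _ = ((n.choose e : ℝ) * (δ * ε') ^ e * C ^ (k * (n - e)) * ((k * (n - e)).choose m : ℝ)) *
        (((k ^ (t + 1) : ℕ) : ℝ) ^ D * ((g * p ^ (t + 1) * (k : ℝ) ^ t) ^ D)⁻¹) := by ring
    _ ≤ ((n.choose e : ℝ) * (δ * ε') ^ e * C ^ (k * (n - e)) * ((k * (n - e)).choose m : ℝ)) *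
        ((k / g) ^ D * (p ^ D)⁻¹) := by gcongr
    _ = _ := by rw [mul_pow]; ring

/-- Counting sites and lines of a graph of height `h`: the powers of `δ` and `p` collected from
all layers give at least one factor `δ` and a factor `p⁻¹` per layer. -/
theorem prod_error_weight_le {k h : ℕ} {p δ : ℝ} (hk : 2 ≤ k) (hp : 1 ≤ p) (hδ0 : 0 ≤ δ)
    (hδ1 : δ ≤ 1) (hpδ : p * δ ^ (k - 1) ≤ 1) (n e : Fin (h + 1) → ℕ) (h0 : n 0 = 1)
    (hen : ∀ t, e t ≤ n t)
    (hn : ∀ t : Fin h, 1 ≤ n t.succ ∧ n t.succ ≤ k * (n t.castSucc - e t.castSucc)) :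
    (∏ t : Fin h, (δ ^ e t.castSucc *
        (p ^ (k * (n t.castSucc - e t.castSucc) - n t.succ))⁻¹)) * δ ^ n (Fin.last h) ≤
      δ * (p ^ h)⁻¹ := by
  have hM : ∑ t : Fin h, e t.castSucc + ∑ t : Fin h, (n t.castSucc - e t.castSucc) =
      ∑ t : Fin h, n t.castSucc := by
    rw [← Finset.sum_add_distrib]
    exact Finset.sum_congr rfl fun t _ => Nat.add_sub_cancel' (hen _)
  have hD : ∑ t : Fin h, (k * (n t.castSucc - e t.castSucc) - n t.succ) +
      ∑ t : Fin h, n t.succ = k * ∑ t : Fin h, (n t.castSucc - e t.castSucc) := by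
    rw [← Finset.sum_add_distrib, Finset.mul_sum]
    exact Finset.sum_congr rfl fun t _ => Nat.sub_add_cancel (hn t).2
  have htel : ∑ t : Fin h, n t.castSucc + n (Fin.last h) = n 0 + ∑ t : Fin h, n t.succ := by
    rw [← Fin.sum_univ_castSucc, Fin.sum_univ_succ]
  have hI : h ≤ ∑ t : Fin h, (n t.castSucc - e t.castSucc) := by
    calc h = ∑ _t : Fin h, 1 := by simp
      _ ≤ _ := Finset.sum_le_sum fun t _ => by
        by_contra hlt
        have hzero : n t.castSucc - e t.castSucc = 0 := by omega
        have := hn t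
        rw [hzero] at this
        omega
  have hlast : 1 ≤ n (Fin.last h) := by
    cases h with
    | zero => exact h0.ge
    | succ h => exact (hn (Fin.last h)).1
  have hp0 : 0 < p := by linarith
  rw [Finset.prod_mul_distrib, Finset.prod_inv_distrib, Finset.prod_pow_eq_pow_sum,
    Finset.prod_pow_eq_pow_sum, mul_right_comm, ← pow_add]
  generalize ∑ t : Fin h, (k * (n t.castSucc - e t.castSucc) - n t.succ) = D at *
  generalize ∑ t : Fin h, (n t.castSucc - e t.castSucc) = I at *
  generalize ∑ t : Fin h, e t.castSucc = E at *
  obtain ⟨j, rfl⟩ : ∃ j, k = j + 1 := ⟨k - 1, by omega⟩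
  rw [Nat.add_sub_cancel] at hpδ
  have hcount : E + n (Fin.last h) + D = 1 + j * I := by
    rw [add_mul] at hD
    omega
  rw [← div_eq_mul_inv, ← div_eq_mul_inv, div_le_div_iff₀ (by positivity) (by positivity)]
  rcases le_total h D with hle | hle
  · calc δ ^ (E + n (Fin.last h)) * p ^ h ≤ δ ^ 1 * p ^ D := by
          have := pow_le_pow_of_le_one hδ0 hδ1 (show 1 ≤ E + n (Fin.last h) by omega)
          gcongr
      _ = δ * p ^ D := by rw [pow_one]
  · obtain ⟨r, rfl⟩ := Nat.exists_eq_add_of_le hle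
    have hr : 1 + j * r ≤ E + n (Fin.last (D + r)) := by
      have h1 : j * (D + r) ≤ j * I := Nat.mul_le_mul_left _ hI
      have h2 : D ≤ j * D := Nat.le_mul_of_pos_left _ (by omega)
      rw [mul_add] at h1
      omega
    calc δ ^ (E + n (Fin.last (D + r))) * p ^ (D + r) ≤ δ ^ (1 + j * r) * p ^ (D + r) := by
          have := pow_le_pow_of_le_one hδ0 hδ1 hr
          gcongr
      _ = δ * p ^ D * (p * δ ^ j) ^ r := by
          rw [mul_pow, ← pow_mul, pow_add, pow_add]
          ring
      _ ≤ δ * p ^ D * 1 := by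
          have : (p * δ ^ j) ^ r ≤ 1 := pow_le_one₀ (by positivity) hpδ
          gcongr
      _ = δ * p ^ D := mul_one _

/-- The weight of the transition from a layer with `s.1` sites, of which `s.2` are errors, to a
layer with `s'.1` sites. -/
noncomputable def layerWeight (k : ℕ) (C a ε : ℝ) {B : ℕ} (s s' : Fin (B + 1) × Fin (B + 1)) : ℝ :=
  ((s.1 : ℕ).choose s.2 : ℝ) * ε ^ (s.2 : ℕ) * C ^ (k * ((s.1 : ℕ) - s.2)) *
    (((k * ((s.1 : ℕ) - s.2)).choose s'.1 : ℝ) * a ^ (k * ((s.1 : ℕ) - s.2) - s'.1))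

/-- The term of the expansion of `(ε + (C (a + x))^k)^n` belonging to `e` errors among `n` sites. -/
noncomputable def errorTerm (k : ℕ) (C a ε x : ℝ) {B : ℕ} (s : Fin (B + 1) × Fin (B + 1)) : ℝ :=
  ((s.1 : ℕ).choose s.2 : ℝ) * ε ^ (s.2 : ℕ) * ((C * (a + x)) ^ k) ^ ((s.1 : ℕ) - s.2)

theorem sum_errorTerm_le {k B : ℕ} {C a ε x : ℝ} (hC : 0 ≤ C) (ha : 0 ≤ a) (hε : 0 ≤ ε)
    (hx : 0 ≤ x) (hfix : ε + (C * (a + x)) ^ k ≤ x) (m : Fin (B + 1)) :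
    ∑ e : Fin (B + 1), errorTerm k C a ε x (m, e) ≤ x ^ (m : ℕ) :=
  (sum_choose_fin_le hε (by positivity) B m).trans (pow_le_pow_left₀ (by positivity) hfix _)

theorem sum_layerWeight_mul_errorTerm_le {k B : ℕ} {C a ε x : ℝ} (hC : 0 ≤ C) (ha : 0 ≤ a)
    (hε : 0 ≤ ε) (hx : 0 ≤ x) (hfix : ε + (C * (a + x)) ^ k ≤ x)
    (s : Fin (B + 1) × Fin (B + 1)) :
    ∑ s', layerWeight k C a ε s s' * errorTerm k C a ε x s' ≤ errorTerm k C a ε x s := by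
  obtain ⟨n, e⟩ := s
  simp only [Fintype.sum_prod_type, layerWeight, ← Finset.mul_sum]
  set N := k * ((n : ℕ) - e) with hN
  calc _ ≤ ∑ m : Fin (B + 1), ((n : ℕ).choose e : ℝ) * ε ^ (e : ℕ) * C ^ N *
          ((N.choose m : ℝ) * a ^ (N - m)) * x ^ (m : ℕ) :=
        Finset.sum_le_sum fun m _ => mul_le_mul_of_nonneg_left
          (sum_errorTerm_le hC ha hε hx hfix m) (by positivity)
    _ = ((n : ℕ).choose e : ℝ) * ε ^ (e : ℕ) * C ^ N *
          ∑ m : Fin (B + 1), (N.choose m : ℝ) * x ^ (m : ℕ) * a ^ (N - m) := by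
        rw [Finset.mul_sum]
        exact Finset.sum_congr rfl fun m _ => by ring
    _ ≤ ((n : ℕ).choose e : ℝ) * ε ^ (e : ℕ) * C ^ N * (x + a) ^ N := by
        have := sum_choose_fin_le hx ha B N
        gcongr
    _ = _ := by
        rw [errorTerm, ← pow_mul, mul_pow, add_comm x a]
        ring

/-- The weighted sum over graphs of height `h` decays like `p⁻ʰ`. -/
theorem S_le {k : ℕ} {C g p δ ε' x : ℝ} (hk : 2 ≤ k) (hC : 0 ≤ C) (hg : 0 < g) (hp : 1 ≤ p)
    (hδ0 : 0 ≤ δ) (hδ1 : δ ≤ 1) (hpδ : p * δ ^ (k - 1) ≤ 1) (hε' : 0 ≤ ε') (hx : 0 ≤ x)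
    (hfix : ε' + (C * (k / g + x)) ^ k ≤ x) (h : ℕ) :
    S k C (fun t => g * p ^ (t + 1) * (k : ℝ) ^ t) h (δ * ε') (δ * ε') ≤
      δ * (p ^ h)⁻¹ * x := by
  have ha : 0 ≤ (k : ℝ) / g := by positivity
  have hp0 : 0 < p := by linarith
  set B := k ^ h with hB
  let w := layerWeight k C (k / g) ε' (B := B)
  let φ := errorTerm k C (k / g) ε' x (B := B)
  let ι : Fin (B + 1) × Fin (B + 1) → ℝ := fun s => if (s.1 : ℕ) = 1 then 1 else 0
  let F : (Fin (h + 1) → Fin (B + 1) × Fin (B + 1)) → ℝ := fun u =>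
    ι (u 0) * (∏ t : Fin h, w (u t.castSucc) (u t.succ)) * φ (u (Fin.last h))
  have hw : ∀ s s', 0 ≤ w s s' := fun s s' => by
    simp only [w, layerWeight]
    positivity
  have hφ : ∀ s, 0 ≤ φ s := fun s => by
    simp only [φ, errorTerm]
    positivity
  have hι : ∀ s, 0 ≤ ι s := fun s => by
    simp only [ι]
    positivity
  have hF : ∀ u, 0 ≤ F u := fun u =>
    mul_nonneg (mul_nonneg (hι _) (Finset.prod_nonneg fun t _ => hw _ _)) (hφ _)
  have hinit : ∑ s, ι s * φ s ≤ x := by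
    have hB1 : 1 < B + 1 := Nat.lt_add_of_pos_left (by positivity)
    rw [Fintype.sum_prod_type, Finset.sum_eq_single (⟨1, hB1⟩ : Fin (B + 1))]
    · simpa [ι] using sum_errorTerm_le hC ha hε' hx hfix (⟨1, hB1⟩ : Fin (B + 1))
    · intro m _ hm
      have hm1 : (m : ℕ) ≠ 1 := fun hm1 => hm (Fin.ext hm1)
      simp [ι, hm1]
    · simp
  have hpath : ∑ u, F u ≤ x := (sum_path_le w φ
    (sum_layerWeight_mul_errorTerm_le hC ha hε' hx hfix) hw h ι hι).trans hinit
  calc _ ≤ ∑ ne : (Fin (h + 1) → Fin (B + 1)) × (Fin (h + 1) → Fin (B + 1)),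
          δ * (p ^ h)⁻¹ * F (fun t => (ne.1 t, ne.2 t)) := by
        unfold S
        refine (Finset.sum_le_sum ?_).trans (Finset.sum_le_univ_sum_of_nonneg fun ne =>
          mul_nonneg (by positivity) (hF fun t => (ne.1 t, ne.2 t)))
        rintro ⟨n, e⟩ hne
        obtain ⟨h0, hen, hn, hlast⟩ := (Finset.mem_filter.mp hne).2
        dsimp only at h0 hen hn hlast ⊢
        have hbound : ∀ t : Fin (h + 1), (n t : ℕ) ≤ k ^ (t : ℕ) := by
          intro t
          induction t using Fin.induction with
          | zero => simp [h0]
          | succ t ih =>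
            rw [Fin.val_succ, pow_succ']
            exact (hn t).2.trans (Nat.mul_le_mul_left _ ((Nat.sub_le _ _).trans ih))
        have hφlast : φ (n (Fin.last h), e (Fin.last h)) = ε' ^ (n (Fin.last h) : ℕ) := by
          simp [φ, errorTerm, hlast]
        have hι0 : ι (n 0, e 0) = 1 := by simp [ι, h0]
        have hweight := prod_error_weight_le hk hp hδ0 hδ1 hpδ (fun t => (n t : ℕ))
          (fun t => (e t : ℕ)) h0 hen hn
        have hprod : 0 ≤ ∏ t : Fin h, w (n t.castSucc, e t.castSucc) (n t.succ, e t.succ) :=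
          Finset.prod_nonneg fun t _ => hw _ _
        have hlayers := Finset.prod_le_prod (s := Finset.univ)
          (fun (t : Fin h) _ => by
            have : 0 ≤ K k ((n t.castSucc : ℕ) - e t.castSucc) (n t.succ) := by
              unfold K
              positivity
            positivity)
          (fun (t : Fin h) _ => layer_le (by omega) hC hg hp hδ0 hε' (hbound t.castSucc)
            (hn t).1 (hn t).2)
        refine (mul_le_mul_of_nonneg_right hlayers (by positivity)).trans ?_
        rw [Finset.prod_mul_distrib]
        simp only [F, hφlast, hι0, one_mul]
        rw [mul_pow]
        calc _ = (∏ t : Fin h, w (n t.castSucc, e t.castSucc) (n t.succ, e t.succ)) *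
              ε' ^ (n (Fin.last h) : ℕ) * ((∏ t : Fin h, (δ ^ (e t.castSucc : ℕ) *
              (p ^ (k * ((n t.castSucc : ℕ) - e t.castSucc) - n t.succ))⁻¹)) *
                δ ^ (n (Fin.last h) : ℕ)) := by
              simp only [w, layerWeight]
              ring
          _ ≤ (∏ t : Fin h, w (n t.castSucc, e t.castSucc) (n t.succ, e t.succ)) *
              ε' ^ (n (Fin.last h) : ℕ) * (δ * (p ^ h)⁻¹) :=
            mul_le_mul_of_nonneg_left hweight (mul_nonneg hprod (by positivity))
          _ = _ := by ring
    _ = δ * (p ^ h)⁻¹ * ∑ u, F u := by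
        rw [← Finset.mul_sum, ← (Equiv.arrowProdEquivProdArrow (Fin (h + 1))
          (fun _ => Fin (B + 1)) (fun _ => Fin (B + 1))).symm.sum_comp F]
        rfl
    _ ≤ _ := by gcongr

/-- The central estimate behind the paper's Theorem: with `γ t = g·p^{t+1}·k^t` and
`ε = δ·ε'`, the sum over all graph heights `t_m ≤ T` of the weighted graph sums is
bounded, uniformly in `T`, by `δ·(p/(p−1))·x̃` with
`x̃ = (1/C)·(1/(C·k))^{1/(k−1)} − k/g`. -/
theorem sum_S_le (k : ℕ) (hk : 2 ≤ k) (C : ℝ) (hC : 1 ≤ C)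
    (g p δ ε' : ℝ) (hg : 0 < g) (hp : 1 < p) (hδ0 : 0 < δ) (hδ1 : δ ≤ 1)
    (hpδ : p * δ ^ (k - 1) ≤ 1) (hε' : 0 ≤ ε')
    (hgcond : (k : ℝ) / g ≤ (1 / C) * (1 / (C * k)) ^ ((1 : ℝ) / (k - 1)) -
        (1 / (C * k)) ^ ((k : ℝ) / (k - 1)))
    (hεcond : ε' ≤ (1 / C) * (1 / (C * k)) ^ ((1 : ℝ) / (k - 1)) -
        (1 / (C * k)) ^ ((k : ℝ) / (k - 1)) - (k : ℝ) / g)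
    (T : ℕ) :
    ∑ tm ∈ Finset.range (T + 1),
        S k C (fun t => g * p ^ (t + 1) * (k : ℝ) ^ t) tm (δ * ε') (δ * ε') ≤
      δ * (p / (p - 1)) *
        ((1 / C) * (1 / (C * k)) ^ ((1 : ℝ) / (k - 1)) - (k : ℝ) / g) := by
  have hk1 : (0 : ℝ) < (k : ℝ) - 1 := by
    have : (2 : ℝ) ≤ k := by exact_mod_cast hk
    linarith
  have hk0 : (0 : ℝ) < k := by linarith
  have hC0 : 0 < C := by linarith
  set y : ℝ := 1 / (C * k) with hy
  have hy0 : 0 < y := by positivity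
  have hq : 0 ≤ y ^ ((k : ℝ) / (k - 1)) := by positivity
  set x : ℝ := 1 / C * y ^ ((1 : ℝ) / (k - 1)) - k / g with hx
  have hpow : (C * (k / g + x)) ^ k = y ^ ((k : ℝ) / (k - 1)) := by
    have hbase : C * (k / g + x) = y ^ ((1 : ℝ) / (k - 1)) := by
      rw [hx]
      field_simp
      ring
    rw [hbase, ← Real.rpow_natCast, ← Real.rpow_mul hy0.le]
    congr 1
    ring
  have hx0 : 0 ≤ x := by linarith
  have hfix : ε' + (C * (k / g + x)) ^ k ≤ x := by
    rw [hpow]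
    linarith
  have hp0 : 0 < p := by linarith
  have hpinv : p⁻¹ < 1 := inv_lt_one_of_one_lt₀ hp
  have hgeom : ∑ tm ∈ Finset.range (T + 1), (p ^ tm)⁻¹ ≤ p / (p - 1) := by
    have hsum := (summable_geometric_of_lt_one (inv_nonneg.mpr hp0.le) hpinv).sum_le_tsum
      (Finset.range (T + 1)) fun _ _ => by positivity
    rw [tsum_geometric_of_lt_one (inv_nonneg.mpr hp0.le) hpinv] at hsum
    simp only [inv_pow] at hsum
    refine hsum.trans (le_of_eq ?_)
    have : p - 1 ≠ 0 := by linarith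
    field_simp
  calc _ ≤ ∑ tm ∈ Finset.range (T + 1), δ * (p ^ tm)⁻¹ * x :=
        Finset.sum_le_sum fun tm _ => S_le hk hC0.le hg hp.le hδ0.le hδ1 hpδ hε' hx0 hfix tm
    _ = δ * (∑ tm ∈ Finset.range (T + 1), (p ^ tm)⁻¹) * x := by
        rw [Finset.mul_sum, Finset.sum_mul]
    _ ≤ _ := by gcongr
end
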